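/- arXiv:1703.07566 — 7 statements merged into one kernel-verified Lean document; each statement's English description precedes it below -/
import Mathlib

section
/- Let b ≥ 1 be a natural number, α, β real numbers and γ a complex number with Re γ = 0, αβ + |γ|² + 4 ≠ 0 and D(α, β, γ, b) ≠ 0. If the associated halfline interface coefficient 𝔠 satisfies Re 𝔠 = 0, then b = 1 (and consequently 𝔞 = α, 𝔟 = β and 𝔠 = γ). -/
/-- Denominator `D(α, β, γ, b) = 4(√b + 1)² + (αβ + |γ|²)(√b − 1)² + 4(1 − b)·Re γ`. -/
noncomputable def Dfun (α β : ℝ) (γ : ℂ) (b : ℕ) : ℝ :=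
  4 * (Real.sqrt b + 1) ^ 2 + (α * β + Complex.normSq γ) * (Real.sqrt b - 1) ^ 2
    + 4 * (1 - (b : ℝ)) * γ.re

/-- Halfline interface coefficient `𝔞 = 16α / D`. -/
noncomputable def coefA (α β : ℝ) (γ : ℂ) (b : ℕ) : ℝ := 16 * α / Dfun α β γ b

/-- Halfline interface coefficient `𝔟 = 16 b β / D`. -/
noncomputable def coefB (α β : ℝ) (γ : ℂ) (b : ℕ) : ℝ := 16 * (b : ℝ) * β / Dfun α β γ b

/-- Halfline interface coefficient
`𝔠 = 2[(1 − b)(4 + αβ + |γ|²) + 8 i √b · Im γ + 4(b + 1)·Re γ] / D`. -/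
noncomputable def coefC (α β : ℝ) (γ : ℂ) (b : ℕ) : ℂ :=
  2 * ((1 - (b : ℂ)) * (4 + (α : ℂ) * (β : ℂ) + (Complex.normSq γ : ℂ))
      + 8 * Complex.I * ((Real.sqrt b : ℝ) : ℂ) * ((γ.im : ℝ) : ℂ)
      + 4 * ((b : ℂ) + 1) * ((γ.re : ℝ) : ℂ)) / ((Dfun α β γ b : ℝ) : ℂ)

/-- The real part of `𝔠` when `Re γ = 0`. -/
theorem coefC_re_of_re_eq_zero (α β : ℝ) {γ : ℂ} (b : ℕ) (hγ : γ.re = 0) :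
    (coefC α β γ b).re
      = 2 * ((1 - (b : ℝ)) * (α * β + Complex.normSq γ + 4)) / Dfun α β γ b := by
  rw [coefC, Complex.div_ofReal_re, hγ]
  simp
  ring

theorem Dfun_one (α β : ℝ) (γ : ℂ) : Dfun α β γ 1 = 16 := by
  norm_num [Dfun]

/-- If `Re γ = 0`, `αβ + |γ|² + 4 ≠ 0`, `D ≠ 0` and `Re 𝔠 = 0`, then `b = 1`,
and consequently `𝔞 = α`, `𝔟 = β`, `𝔠 = γ`. -/
theorem stmt1 (α β : ℝ) (γ : ℂ) (b : ℕ) (hb : 1 ≤ b)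
    (hγ : γ.re = 0) (h4 : α * β + Complex.normSq γ + 4 ≠ 0)
    (hD : Dfun α β γ b ≠ 0)
    (hc : (coefC α β γ b).re = 0) :
    b = 1 ∧ coefA α β γ b = α ∧ coefB α β γ b = β ∧ coefC α β γ b = γ := by
  obtain rfl : b = 1 := by
    rw [coefC_re_of_re_eq_zero α β b hγ] at hc
    have h : 1 - (b : ℝ) = 0 := by simpa [hD, h4] using hc
    exact_mod_cast (sub_eq_zero.mp h).symm
  refine ⟨rfl, ?_, ?_, ?_⟩
  · rw [coefA, Dfun_one]
    ring
  · rw [coefB, Dfun_one]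
    push_cast
    ring
  · rw [coefC, Dfun_one, hγ]
    apply Complex.ext
    · simp [hγ]
    · simp
      ring
end

section
/- Let b ≥ 1 be a natural number, α, β real numbers and γ a complex number with Re γ = 0 and D(α, β, γ, b) ≠ 0, and suppose the associated halfline interface coefficient 𝔠 satisfies Re 𝔠 ≠ 0. Then αβ + (Im γ)² = (8(1 − b) − 4·Re 𝔠·(√b + 1)²) / (Re 𝔠·(√b − 1)² − 2(1 − b)), the denominator being nonzero. -/
/-- For `Re γ = 0`, clearing denominators: `Re 𝔠 · D = 2(1 − b)(4 + αβ + |γ|²)`. -/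
theorem coefC_re_mul_Dfun {α β : ℝ} {γ : ℂ} {b : ℕ} (hγ : γ.re = 0) (hD : Dfun α β γ b ≠ 0) :
    (coefC α β γ b).re * Dfun α β γ b =
      2 * (1 - (b : ℝ)) * (4 + α * β + Complex.normSq γ) := by
  rw [coefC, Complex.div_ofReal_re, div_mul_cancel₀ _ hD]
  simp [hγ]
  ring

/-- If `Re γ = 0`, `D ≠ 0` and `Re 𝔠 ≠ 0`, then
`αβ + (Im γ)² = (8(1 − b) − 4 Re 𝔠 (√b + 1)²) / (Re 𝔠 (√b − 1)² − 2(1 − b))`,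
the denominator being nonzero. -/
theorem stmt4 (α β : ℝ) (γ : ℂ) (b : ℕ) (hb : 1 ≤ b)
    (hγ : γ.re = 0) (hD : Dfun α β γ b ≠ 0)
    (hc : (coefC α β γ b).re ≠ 0) :
    (coefC α β γ b).re * (Real.sqrt b - 1) ^ 2 - 2 * (1 - (b : ℝ)) ≠ 0 ∧
    α * β + γ.im ^ 2 =
      (8 * (1 - (b : ℝ)) - 4 * (coefC α β γ b).re * (Real.sqrt b + 1) ^ 2) /
        ((coefC α β γ b).re * (Real.sqrt b - 1) ^ 2 - 2 * (1 - (b : ℝ))) := by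
  have key := coefC_re_mul_Dfun hγ hD
  generalize (coefC α β γ b).re = r at hc key ⊢
  simp only [Dfun, Complex.normSq_apply, hγ] at key
  have hs : 0 < Real.sqrt b := Real.sqrt_pos.2 (by exact_mod_cast hb)
  have hsq : Real.sqrt b ^ 2 = (b : ℝ) := Real.sq_sqrt (Nat.cast_nonneg b)
  have hlin : (α * β + γ.im ^ 2) * (r * (Real.sqrt b - 1) ^ 2 - 2 * (1 - (b : ℝ))) =
      8 * (1 - (b : ℝ)) - 4 * r * (Real.sqrt b + 1) ^ 2 := by
    linear_combination key
  have hne : r * (Real.sqrt b - 1) ^ 2 - 2 * (1 - (b : ℝ)) ≠ 0 := by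
    intro h0
    rw [h0, mul_zero] at hlin
    refine mul_ne_zero hc hs.ne' ?_
    linear_combination -(1 / 4) * h0 + (1 / 16) * hlin
  exact ⟨hne, (eq_div_iff hne).2 hlin⟩
end

section
/- Let b ≥ 1 be a natural number, α, β real numbers and γ a complex number with Re γ = 0 and D(α, β, γ, b) ≠ 0, and suppose the associated halfline interface coefficients 𝔞, 𝔟, 𝔠 satisfy Re 𝔠 ≠ 0. Set I = −32(1 − b)√b / (Re 𝔠·(√b − 1)² − 2(1 − b)). Then α = (𝔞/16)·I, β = (𝔟/(16b))·I, and Im γ = (Im 𝔠/(16√b))·I. -/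
theorem coefC_re (α β : ℝ) (γ : ℂ) (b : ℕ) :
    (coefC α β γ b).re = 2 * ((1 - (b : ℝ)) * (4 + α * β + Complex.normSq γ)
      + 4 * ((b : ℝ) + 1) * γ.re) / Dfun α β γ b := by
  rw [coefC, Complex.div_ofReal_re]
  simp

theorem coefC_im (α β : ℝ) (γ : ℂ) (b : ℕ) :
    (coefC α β γ b).im = 16 * Real.sqrt b * γ.im / Dfun α β γ b := by
  rw [coefC, Complex.div_ofReal_im]
  congr 1
  simp
  ring

/-- The quotient `I` recovers the denominator `D`. -/
theorem quotient_eq_Dfun {α β : ℝ} {γ : ℂ} {b : ℕ} (hb : 1 ≤ b)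
    (hγ : γ.re = 0) (hD : Dfun α β γ b ≠ 0) (hc : (coefC α β γ b).re ≠ 0) :
    -32 * (1 - (b : ℝ)) * Real.sqrt b /
      ((coefC α β γ b).re * (Real.sqrt b - 1) ^ 2 - 2 * (1 - (b : ℝ))) = Dfun α β γ b := by
  have hs : Real.sqrt b ≠ 0 := by positivity
  have hb1 : 1 - (b : ℝ) ≠ 0 := by
    intro h
    simp [coefC_re, hγ, h] at hc
  have hden : (coefC α β γ b).re * (Real.sqrt b - 1) ^ 2 - 2 * (1 - (b : ℝ)) =
      -32 * (1 - (b : ℝ)) * Real.sqrt b / Dfun α β γ b := by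
    rw [coefC_re, hγ, eq_div_iff hD, sub_mul, mul_right_comm, div_mul_cancel₀ _ hD, Dfun, hγ]
    ring
  rw [hden, div_div_cancel₀]
  exact mul_ne_zero (mul_ne_zero (by norm_num) hb1) hs

/-- If `Re γ = 0`, `D ≠ 0` and `Re 𝔠 ≠ 0`, then with
`I = −32(1 − b)√b / (Re 𝔠·(√b − 1)² − 2(1 − b))` one has
`α = (𝔞/16)·I`, `β = (𝔟/(16b))·I`, `Im γ = (Im 𝔠/(16√b))·I`. -/
theorem stmt5 (α β : ℝ) (γ : ℂ) (b : ℕ) (hb : 1 ≤ b)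
    (hγ : γ.re = 0) (hD : Dfun α β γ b ≠ 0)
    (hc : (coefC α β γ b).re ≠ 0) :
    α = coefA α β γ b / 16 *
        (-32 * (1 - (b : ℝ)) * Real.sqrt b /
          ((coefC α β γ b).re * (Real.sqrt b - 1) ^ 2 - 2 * (1 - (b : ℝ)))) ∧
    β = coefB α β γ b / (16 * (b : ℝ)) *
        (-32 * (1 - (b : ℝ)) * Real.sqrt b /
          ((coefC α β γ b).re * (Real.sqrt b - 1) ^ 2 - 2 * (1 - (b : ℝ)))) ∧
    γ.im = (coefC α β γ b).im / (16 * Real.sqrt b) *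
        (-32 * (1 - (b : ℝ)) * Real.sqrt b /
          ((coefC α β γ b).re * (Real.sqrt b - 1) ^ 2 - 2 * (1 - (b : ℝ)))) := by
  have hs : Real.sqrt b ≠ 0 := by positivity
  have hb0 : (b : ℝ) ≠ 0 := by positivity
  rw [quotient_eq_Dfun hb hγ hD hc, coefC_im, coefA, coefB]
  refine ⟨?_, ?_, ?_⟩ <;> field_simp
end

section
/- The map (α, β, γ, b) ↦ (𝔞, 𝔟, 𝔠) sending vertex-coupling data to the associated halfline interface coefficients is injective on the set of all tuples (α, β, γ, b) with b ≥ 1 a natural number, α, β real, γ complex, Re γ = 0, αβ + |γ|² + 4 ≠ 0, and D(α, β, γ, b) ≠ 0. That is, if two such tuples (α, β, γ, b) and (α', β', γ', b') produce the same coefficients (𝔞, 𝔟, 𝔠), then α = α', β = β', γ = γ' and b = b'. -/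
/-- The quadratic equation satisfied by `u = 16 s / D`, with coefficients given by the interface
coefficients through `K = 𝔞𝔟 + (Im 𝔠)²` and `c = Re 𝔠`. -/
lemma interface_quadratic {s u v P K c : ℝ} (h1 : u + v * (s - 1) ^ 2 = 1)
    (hK : K = u ^ 2 * P) (hE : 16 * s * v = u * (P + 4)) (hc : c = 2 * v * (1 - s ^ 2)) :
    4 * u ^ 2 + (K - 4 + c ^ 2) * u - K = 0 := by
  have hcc : c ^ 2 = 4 * (1 - u) * (1 - u + 4 * s * v) := by
    obtain rfl : u = 1 - v * (s - 1) ^ 2 := by linarith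
    rw [hc]; ring
  rw [hcc, hK]
  linear_combination u * (1 - u) * hE

/-- The parameter `s = √b` is determined by `K = 𝔞𝔟 + (Im 𝔠)²` and `c = Re 𝔠`, and so is
`u = 16 s / D`. -/
lemma interface_parameters_unique {s u v P s' u' v' P' K c : ℝ} (hs : 1 ≤ s) (hs' : 1 ≤ s')
    (hv : v ≠ 0) (hv' : v' ≠ 0)
    (h1 : u + v * (s - 1) ^ 2 = 1) (h1' : u' + v' * (s' - 1) ^ 2 = 1)
    (hK : K = u ^ 2 * P) (hK' : K = u' ^ 2 * P')
    (hE : 16 * s * v = u * (P + 4)) (hE' : 16 * s' * v' = u' * (P' + 4))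
    (hc : c = 2 * v * (1 - s ^ 2)) (hc' : c = 2 * v' * (1 - s' ^ 2)) :
    s = s' ∧ u = u' := by
  have key : ∀ {t w : ℝ}, 1 ≤ t → w ≠ 0 → c = 2 * w * (1 - t ^ 2) → c = 0 → t = 1 := by
    intro t w ht hw h h0
    have h2 : 1 - t ^ 2 = 0 := by
      rw [h0] at h
      simpa [hw] using h.symm
    nlinarith
  by_cases h0 : c = 0
  · obtain rfl := key hs hv hc h0
    obtain rfl := key hs' hv' hc' h0
    exact ⟨rfl, by linarith⟩
  have hs1 : s - 1 ≠ 0 := by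
    intro h
    apply h0
    rw [hc]
    linear_combination (-2 * v * (1 + s)) * h
  have hs1' : s' - 1 ≠ 0 := by
    intro h
    apply h0
    rw [hc']
    linear_combination (-2 * v' * (1 + s')) * h
  have q := interface_quadratic h1 hK hE hc
  have q' := interface_quadratic h1' hK' hE' hc'
  by_cases hu : u = u'
  · refine ⟨?_, hu⟩
    have e1 : v * (s - 1) ^ 2 = v' * (s' - 1) ^ 2 := by linarith
    have e2 : v * (s ^ 2 - 1) = v' * (s' ^ 2 - 1) := by linarith
    have e3 : (v * (s - 1) * (s' - 1)) * (s - s') = 0 := by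
      have : v' * (s' - 1) * ((s - 1) * (s' + 1) - (s + 1) * (s' - 1)) = 0 := by
        have h : (s - 1) * ((s - 1) * (v' * (s' ^ 2 - 1)) - (s + 1) * (v' * (s' - 1) ^ 2)) = 0 := by
          rw [← e1, ← e2]; ring
        have h2 := (mul_eq_zero.mp h).resolve_left hs1
        linear_combination h2
      have h3 : v' * (s' - 1) ≠ 0 := mul_ne_zero hv' hs1'
      have h4 := (mul_eq_zero.mp this).resolve_left h3
      linear_combination (v * (s - 1) * (s' - 1)) * h4 / 2
    exact sub_eq_zero.mp ((mul_eq_zero.mp e3).resolve_left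
      (mul_ne_zero (mul_ne_zero hv hs1) hs1'))
  · exfalso
    have hsum : 4 * (u + u') + K - 4 + c ^ 2 = 0 := by
      refine (mul_eq_zero.mp ?_).resolve_left (sub_ne_zero.mpr hu)
      linear_combination q - q'
    have hprod : c ^ 2 = 4 * (1 - u) * (1 - u') := by
      linear_combination (1 - u) * hsum + q
    have hprod' : c ^ 2 = 4 * (v * (1 - s ^ 2)) * (v' * (1 - s' ^ 2)) := by
      calc c ^ 2 = c * c := sq c
        _ = (2 * v * (1 - s ^ 2)) * (2 * v' * (1 - s' ^ 2)) := by rw [← hc, ← hc']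
        _ = _ := by ring
    have hz : (v * v' * (s - 1) * (s' - 1)) * (s + s') = 0 := by
      have e : 1 - u = v * (s - 1) ^ 2 := by linarith
      have e' : 1 - u' = v' * (s' - 1) ^ 2 := by linarith
      rw [mul_assoc, e, e'] at hprod
      linear_combination (hprod - hprod') / 8
    have : s + s' ≠ 0 := by positivity
    simp_all

/-- Real form of the interface map: for `γ = i g` and `s = √b`, the data `(α, β, g, s)` are
determined by the coefficients. -/
lemma interface_real_injective {α β g s D α' β' g' s' D' : ℝ} (hs : 1 ≤ s) (hs' : 1 ≤ s')
    (hE : α * β + g ^ 2 + 4 ≠ 0) (hE' : α' * β' + g' ^ 2 + 4 ≠ 0)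
    (hD : D ≠ 0) (hD' : D' ≠ 0)
    (hDdef : D = 4 * (s + 1) ^ 2 + (α * β + g ^ 2) * (s - 1) ^ 2)
    (hDdef' : D' = 4 * (s' + 1) ^ 2 + (α' * β' + g' ^ 2) * (s' - 1) ^ 2)
    (ha : 16 * α / D = 16 * α' / D')
    (hb : 16 * s ^ 2 * β / D = 16 * s' ^ 2 * β' / D')
    (hcr : 2 * ((1 - s ^ 2) * (4 + α * β + g ^ 2)) / D
      = 2 * ((1 - s' ^ 2) * (4 + α' * β' + g' ^ 2)) / D')
    (hci : 16 * s * g / D = 16 * s' * g' / D') :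
    α = α' ∧ β = β' ∧ g = g' ∧ s = s' := by
  have hs0 : s ≠ 0 := by positivity
  have huniq := interface_parameters_unique (s := s) (s' := s')
    (u := 16 * s / D) (u' := 16 * s' / D')
    (v := (α * β + g ^ 2 + 4) / D) (v' := (α' * β' + g' ^ 2 + 4) / D')
    (P := α * β + g ^ 2) (P' := α' * β' + g' ^ 2)
    (K := (16 * α / D) * (16 * s ^ 2 * β / D) + (16 * s * g / D) ^ 2)
    (c := 2 * ((1 - s ^ 2) * (4 + α * β + g ^ 2)) / D) hs hs'
    (div_ne_zero hE hD) (div_ne_zero hE' hD')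
    (by field_simp; rw [hDdef]; ring) (by field_simp; rw [hDdef']; ring)
    (by ring) (by rw [ha, hb, hci]; ring) (by ring) (by ring) (by ring) (by rw [hcr]; ring)
  obtain ⟨rfl, hu⟩ := huniq
  have hDD : D = D' := by
    field_simp at hu
    linarith
  subst hDD
  field_simp at ha hb hci
  exact ⟨ha, hb, hci, rfl⟩

/-- The map `(α, β, γ, b) ↦ (𝔞, 𝔟, 𝔠)` is injective on tuples with `b ≥ 1`,
`Re γ = 0`, `αβ + |γ|² + 4 ≠ 0` and `D(α, β, γ, b) ≠ 0`. -/
theorem stmt8 (α β : ℝ) (γ : ℂ) (b : ℕ) (α' β' : ℝ) (γ' : ℂ) (b' : ℕ)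
    (hb : 1 ≤ b) (hb' : 1 ≤ b')
    (hγ : γ.re = 0) (hγ' : γ'.re = 0)
    (h4 : α * β + Complex.normSq γ + 4 ≠ 0)
    (h4' : α' * β' + Complex.normSq γ' + 4 ≠ 0)
    (hD : Dfun α β γ b ≠ 0) (hD' : Dfun α' β' γ' b' ≠ 0)
    (ha : coefA α β γ b = coefA α' β' γ' b')
    (hbb : coefB α β γ b = coefB α' β' γ' b')
    (hc : coefC α β γ b = coefC α' β' γ' b') :
    α = α' ∧ β = β' ∧ γ = γ' ∧ b = b' := by
  have hsq : ∀ n : ℕ, Real.sqrt n ^ 2 = n := fun n => Real.sq_sqrt n.cast_nonneg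
  have hone : ∀ n : ℕ, 1 ≤ n → 1 ≤ Real.sqrt n := fun n hn =>
    Real.one_le_sqrt.mpr (by exact_mod_cast hn)
  have hnorm : ∀ z : ℂ, z.re = 0 → Complex.normSq z = z.im ^ 2 := fun z hz => by
    rw [Complex.normSq_apply, hz]; ring
  have hre : ∀ (x y : ℝ) (z : ℂ) (n : ℕ), z.re = 0 → (coefC x y z n).re =
      2 * ((1 - Real.sqrt n ^ 2) * (4 + x * y + z.im ^ 2)) / Dfun x y z n := by
    intro x y z n hz
    rw [coefC, Complex.div_ofReal_re, ← hnorm z hz, hz, hsq]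
    simp
  have him : ∀ (x y : ℝ) (z : ℂ) (n : ℕ), z.re = 0 → (coefC x y z n).im =
      16 * Real.sqrt n * z.im / Dfun x y z n := by
    intro x y z n hz
    rw [coefC, Complex.div_ofReal_im, hz]
    simp
    ring
  have hDeq : ∀ (x y : ℝ) (z : ℂ) (n : ℕ), z.re = 0 → Dfun x y z n =
      4 * (Real.sqrt n + 1) ^ 2 + (x * y + z.im ^ 2) * (Real.sqrt n - 1) ^ 2 := by
    intro x y z n hz
    rw [Dfun, hnorm z hz, hz]
    ring
  have hcr := congrArg Complex.re hc
  have hci := congrArg Complex.im hc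
  rw [hre _ _ _ _ hγ, hre _ _ _ _ hγ'] at hcr
  rw [him _ _ _ _ hγ, him _ _ _ _ hγ'] at hci
  rw [coefB, coefB, ← hsq b, ← hsq b'] at hbb
  rw [hnorm _ hγ] at h4
  rw [hnorm _ hγ'] at h4'
  obtain ⟨h₁, h₂, h₃, h₄⟩ := interface_real_injective (hone b hb) (hone b' hb') h4 h4' hD hD'
    (hDeq _ _ _ _ hγ) (hDeq _ _ _ _ hγ') ha hbb hcr hci
  refine ⟨h₁, h₂, Complex.ext (hγ.trans hγ'.symm) h₃, ?_⟩
  have : (b : ℝ) = b' := by rw [← hsq b, ← hsq b', h₄]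
  exact_mod_cast this
end

section
/- Let b ≥ 1 be a natural number, α, β real numbers and γ a complex number with Re γ = 0 and D(α, β, γ, b) ≠ 0, and let 𝔞, 𝔟, 𝔠 be the associated halfline interface coefficients. If Im 𝔠 = 0 and 𝔞𝔟 + |𝔠|² = 4, then Im γ = 0 (hence γ = 0) and αβ + |γ|² = 4. In other words, if the halfline interface conditions are separating, then the vertex conditions are separating. -/
/-- If `Re γ = 0`, `D ≠ 0` and the halfline interface conditions are separating
(`Im 𝔠 = 0` and `𝔞𝔟 + |𝔠|² = 4`), then `Im γ = 0` (hence `γ = 0`)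
and `αβ + |γ|² = 4`, i.e. the vertex conditions are separating. -/
theorem stmt9 (α β : ℝ) (γ : ℂ) (b : ℕ) (hb : 1 ≤ b)
    (hγ : γ.re = 0) (hD : Dfun α β γ b ≠ 0)
    (hcim : (coefC α β γ b).im = 0)
    (hsep : coefA α β γ b * coefB α β γ b + Complex.normSq (coefC α β γ b) = 4) :
    γ.im = 0 ∧ γ = 0 ∧ α * β + Complex.normSq γ = 4 := by
  have hb0 : (0 : ℝ) < b := by exact_mod_cast hb
  have hsqrt : 0 < √(b : ℝ) := Real.sqrt_pos.mpr hb0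
  have hsq : (b : ℝ) = √(b : ℝ) ^ 2 := (Real.sq_sqrt hb0.le).symm
  have hC : coefC α β γ b =
      ((2 * (1 - (b : ℝ)) * (4 + α * β + Complex.normSq γ) / Dfun α β γ b : ℝ) : ℂ)
        + ((16 * √(b : ℝ) * γ.im / Dfun α β γ b : ℝ) : ℂ) * Complex.I := by
    simp only [coefC, hγ]
    push_cast
    ring
  have him : γ.im = 0 := by
    rw [hC, Complex.add_im, Complex.ofReal_im, Complex.im_ofReal_mul, Complex.I_im] at hcim
    simpa [hD, hsqrt.ne'] using hcim
  have hγ0 : γ = 0 := Complex.ext hγ him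
  refine ⟨him, hγ0, ?_⟩
  subst hγ0
  rw [hC] at hsep
  simp only [coefA, coefB, Complex.zero_im, mul_zero, zero_div, Complex.ofReal_zero, zero_mul,
    add_zero, map_zero, Complex.normSq_ofReal] at hsep ⊢
  have hDval : Dfun α β 0 b = 4 * (√(b : ℝ) + 1) ^ 2 + α * β * (√(b : ℝ) - 1) ^ 2 := by
    simp [Dfun]
  field_simp at hsep
  have hfactor : √(b : ℝ) * Dfun α β 0 b * (α * β - 4) = 0 := by
    rw [hDval] at hsep ⊢
    rw [hsq, Real.sqrt_sq hsqrt.le] at hsep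
    linear_combination hsep / 16
  have := (mul_eq_zero.mp hfactor).resolve_left (mul_ne_zero hsqrt.ne' hD)
  linarith
end

section
/- Let b ≥ 1 be a natural number and α, β real numbers with αβ = 4, and let γ = 0. Then D(α, β, 0, b) = 8(b + 1), which is nonzero, and the associated halfline interface coefficients satisfy Im 𝔠 = 0 and 𝔞𝔟 + |𝔠|² = 4. In other words, separating vertex conditions with Re γ = 0 give rise to separating halfline interface conditions. -/
theorem Dfun_zero_of_mul_eq_four {α β : ℝ} (b : ℕ) (hαβ : α * β = 4) :
    Dfun α β 0 b = 8 * ((b : ℝ) + 1) := by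
  have hs : Real.sqrt b ^ 2 = b := Real.sq_sqrt b.cast_nonneg
  simp only [Dfun, hαβ, map_zero, Complex.zero_re]
  linear_combination 8 * hs

theorem coefC_zero_of_mul_eq_four {α β : ℝ} (b : ℕ) (hαβ : α * β = 4) :
    coefC α β 0 b = ((2 * (1 - (b : ℝ)) / ((b : ℝ) + 1) : ℝ) : ℂ) := by
  have hαβ' : (α : ℂ) * β = 4 := by exact_mod_cast hαβ
  have hb : (b : ℂ) + 1 ≠ 0 := by exact_mod_cast b.succ_ne_zero
  simp only [coefC, Dfun_zero_of_mul_eq_four b hαβ, hαβ', map_zero, Complex.zero_re,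
    Complex.zero_im]
  push_cast
  field_simp
  ring

/-- If `αβ = 4` and `γ = 0`, then `D(α, β, 0, b) = 8(b + 1) ≠ 0` and the
halfline interface conditions are separating: `Im 𝔠 = 0` and `𝔞𝔟 + |𝔠|² = 4`. -/
theorem stmt10 (α β : ℝ) (b : ℕ) (hb : 1 ≤ b) (hαβ : α * β = 4) :
    Dfun α β 0 b = 8 * ((b : ℝ) + 1) ∧ Dfun α β 0 b ≠ 0 ∧
    (coefC α β 0 b).im = 0 ∧
    coefA α β 0 b * coefB α β 0 b + Complex.normSq (coefC α β 0 b) = 4 := by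
  have hb1 : (b : ℝ) + 1 ≠ 0 := by positivity
  have hD := Dfun_zero_of_mul_eq_four b hαβ
  refine ⟨hD, ?_, ?_, ?_⟩
  · rw [hD]
    positivity
  · rw [coefC_zero_of_mul_eq_four b hαβ, Complex.ofReal_im]
  · rw [coefC_zero_of_mul_eq_four b hαβ, Complex.normSq_ofReal, coefA, coefB, hD]
    field_simp
    linear_combination 256 * (b : ℝ) * hαβ
end

section
/- Let b ≥ 1 be a natural number, α, β real numbers and γ a complex number with Re γ = 0 and D(α, β, γ, b) ≠ 0, and suppose the associated halfline interface coefficients satisfy Re 𝔠 ≠ 0, Im 𝔠 = 0, and 𝔞𝔟 = 4 − (Re 𝔠)². Then b = (2 − Re 𝔠) / (2 + Re 𝔠) and αβ + |γ|² = 4. -/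
theorem coefC_eq (α β : ℝ) (γ : ℂ) (b : ℕ) :
    coefC α β γ b =
      ⟨2 * ((1 - (b : ℝ)) * (4 + α * β + Complex.normSq γ) + 4 * ((b : ℝ) + 1) * γ.re)
          / Dfun α β γ b,
        16 * Real.sqrt b * γ.im / Dfun α β γ b⟩ := by
  rw [Complex.mk_eq_add_mul_I, coefC]
  push_cast
  ring

/-- If `Re γ = 0`, `D ≠ 0`, `Re 𝔠 ≠ 0`, `Im 𝔠 = 0` and `𝔞𝔟 = 4 − (Re 𝔠)²`,
then `b = (2 − Re 𝔠)/(2 + Re 𝔠)` and `αβ + |γ|² = 4`. -/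
theorem stmt11 (α β : ℝ) (γ : ℂ) (b : ℕ) (hb : 1 ≤ b)
    (hγ : γ.re = 0) (hD : Dfun α β γ b ≠ 0)
    (hcre : (coefC α β γ b).re ≠ 0) (hcim : (coefC α β γ b).im = 0)
    (hab : coefA α β γ b * coefB α β γ b = 4 - (coefC α β γ b).re ^ 2) :
    (b : ℝ) = (2 - (coefC α β γ b).re) / (2 + (coefC α β γ b).re) ∧
    α * β + Complex.normSq γ = 4 := by
  have hb0 : (0 : ℝ) < b := by exact_mod_cast hb
  have hs : 0 < Real.sqrt b := Real.sqrt_pos.mpr hb0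
  have hsq : Real.sqrt b ^ 2 = b := Real.sq_sqrt hb0.le
  have him : γ.im = 0 := by
    simpa [coefC_eq, hD, hs.ne'] using hcim
  have hγ0 : γ = 0 := Complex.ext hγ him
  subst hγ0
  have hDef : Dfun α β 0 b
      = 4 * (Real.sqrt b + 1) ^ 2 + α * β * (Real.sqrt b - 1) ^ 2 := by
    simp [Dfun]
  have hC : (coefC α β 0 b).re = 2 * ((1 - (b : ℝ)) * (4 + α * β)) / Dfun α β 0 b := by
    simp [coefC_eq]
  have hX : α * β = 4 := by
    rw [hC, coefA, coefB] at hab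
    field_simp at hab
    have hfac : 16 * Real.sqrt b * (α * β - 4) * Dfun α β 0 b = 0 := by
      rw [← hsq] at hab
      rw [hDef] at hab ⊢
      linear_combination hab
    have h := (mul_eq_zero.mp hfac).resolve_right hD
    have h' := (mul_eq_zero.mp h).resolve_left (by positivity)
    linarith
  have hD8 : Dfun α β 0 b = 8 * (b + 1) := by
    rw [hDef, hX]
    linear_combination 8 * hsq
  refine ⟨?_, by simpa using hX⟩
  have hb1 : (b : ℝ) + 1 ≠ 0 := by positivity
  have hre : (coefC α β 0 b).re = 2 * (1 - b) / (b + 1) := by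
    rw [hC, hX, hD8]
    field_simp
    ring
  have hsum : 2 + (coefC α β 0 b).re = 4 / (b + 1) := by
    rw [hre]
    field_simp
    ring
  rw [hsum, hre]
  field_simp
  ring
end
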